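/- arXiv:1912.12200 — 6 statements merged into one kernel-verified Lean document; each statement's English description precedes it below -/
import Mathlib

section
/- Let E be a 2-dimensional K-vector space and let q₁, q₂ be nonzero symmetric bilinear forms on E having the same set of isotropic vectors, and suppose this common set contains a nonzero vector. Then q₂ = k·q₁ for some nonzero scalar k ∈ K. -/
/-- Two nonzero symmetric bilinear forms on a 2-dimensional vector space with
the same set of isotropic vectors, containing at least one nonzero vector,
are proportional. -/
theorem proportional_of_same_isotropics {K E : Type*} [Field K] (h2 : (2 : K) ≠ 0)
    [AddCommGroup E] [Module K E] (hdim : Module.finrank K E = 2)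
    (q₁ q₂ : LinearMap.BilinForm K E)
    (hsymm₁ : ∀ x y, q₁ x y = q₁ y x) (hsymm₂ : ∀ x y, q₂ x y = q₂ y x)
    (hq₁ : q₁ ≠ 0) (hq₂ : q₂ ≠ 0)
    (hsame : {v : E | q₁ v v = 0} = {v : E | q₂ v v = 0})
    (hnonzero : ∃ v : E, v ≠ 0 ∧ q₁ v v = 0) :
    ∃ k : K, k ≠ 0 ∧ q₂ = k • q₁ := by
  obtain ⟨v, hv, hv1⟩ := hnonzero
  have hs : ∀ x, q₁ x x = 0 ↔ q₂ x x = 0 := fun x => Set.ext_iff.1 hsame x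
  have hv2 := (hs v).1 hv1
  obtain ⟨w, hw⟩ := exists_linearIndependent_pair_of_one_lt_finrank (R := K) (by omega) hv
  let b := basisOfLinearIndependentOfCardEqFinrank hw (by simp [hdim])
  have hb0 : b 0 = v := by simp [b]
  have hb1 : b 1 = w := by simp [b]
  have e1 : ∀ s t : K, q₁ (s • v + t • w) (s • v + t • w)
      = 2 * s * t * q₁ v w + t * t * q₁ w w := by
    intro s t
    simp only [map_add, map_smul, LinearMap.add_apply, LinearMap.smul_apply, smul_eq_mul, hv1,
      hsymm₁ w v]
    ring
  have e2 : ∀ s t : K, q₂ (s • v + t • w) (s • v + t • w)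
      = 2 * s * t * q₂ v w + t * t * q₂ w w := by
    intro s t
    simp only [map_add, map_smul, LinearMap.add_apply, LinearMap.smul_apply, smul_eq_mul, hv2,
      hsymm₂ w v]
    ring
  have ext2 : ∀ q q' : LinearMap.BilinForm K E, q v v = q' v v → q v w = q' v w →
      q w v = q' w v → q w w = q' w w → q = q' := by
    intro q q' h1 h2 h3 h4
    refine b.ext fun i => b.ext fun j => ?_
    fin_cases i <;> fin_cases j <;> simp [hb0, hb1, h1, h2, h3, h4]
  suffices h : ∃ k : K, q₂ v w = k * q₁ v w ∧ q₂ w w = k * q₁ w w by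
    obtain ⟨k, h1, h3⟩ := h
    have hk : q₂ = k • q₁ := by
      apply ext2
      · simp [hv1, hv2]
      · simp [h1]
      · simp [hsymm₂ w v, hsymm₁ w v, h1]
      · simp [h3]
    refine ⟨k, ?_, hk⟩
    rintro rfl
    exact hq₂ (by simp [hk])
  by_cases hβ : q₁ v w = 0
  · have hγ : q₁ w w ≠ 0 := by
      intro h
      apply hq₁
      apply ext2 <;> simp [hv1, hβ, h, hsymm₁ w v]
    have h := (hs (-(q₂ w w) • v + (2 * q₂ v w) • w)).2 (by rw [e2]; ring)
    rw [e1, hβ] at h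
    have hβ2 : q₂ v w = 0 := by simpa [h2, hγ] using h
    exact ⟨q₂ w w / q₁ w w, by simp [hβ, hβ2], by field_simp⟩
  · have h := (hs (-(q₁ w w) • v + (2 * q₁ v w) • w)).1 (by rw [e1]; ring)
    rw [e2] at h
    have h' : (2 * 2 * q₁ v w) * (q₁ v w * q₂ w w - q₂ v w * q₁ w w) = 0 := by
      linear_combination h
    have h3 : q₁ v w * q₂ w w - q₂ v w * q₁ w w = 0 := by
      simpa [h2, hβ] using h'
    refine ⟨q₂ v w / q₁ v w, by field_simp, ?_⟩
    field_simp
    linear_combination h3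
end

section
/- Let a, b, c ∈ K with a² + b·c ≠ 0 (so that the traceless matrix T = [[a, b], [c, −a]] is invertible). For any x, y ∈ K set x' = a·x + b·y, y' = c·x − a·y, z = −(1/2)·(y·x' + x·y'), and let Q be the symmetric matrix [[y·y', z], [z, x·x']]. Then: (1) both (x, y) and (x', y') are isotropic vectors of Q, i.e., the quadratic form of Q vanishes at both; and (2) ⟨Q, D⟩ = 0 where D = [[−c, a], [a, b]] is the Desargues form of T. That is, each pair of conjugate points of the involution determined by T spans a symmetric bilinear form orthogonal to the Desargues form under the determinant pairing. -/
open Matrix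

/-- The determinant pairing on 2×2 matrices over a field `K`:
`⟨M, N⟩ = (1/2)·(M₀₀·N₁₁ + M₁₁·N₀₀) − M₀₁·N₀₁`. -/
def detPairing {K : Type*} [Field K] (M N : Matrix (Fin 2) (Fin 2) K) : K :=
  (1 / 2 : K) * (M 0 0 * N 1 1 + M 1 1 * N 0 0) - M 0 1 * N 0 1

/-- For the involution of the projective line induced by the invertible
traceless matrix `T = [[a, b], [c, −a]]`, each pair of conjugate points
`(x, y)`, `(x', y')` gives a symmetric bilinear form `Q` having them as
isotropic vectors, and `Q` is orthogonal to the Desargues form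
`D = [[−c, a], [a, b]]` under the determinant pairing. -/
theorem conjugate_pair_form_orthogonal_to_desargues {K : Type*} [Field K]
    (h2 : (2 : K) ≠ 0) (a b c : K) (hT : a ^ 2 + b * c ≠ 0) (x y : K) :
    let x' := a * x + b * y
    let y' := c * x - a * y
    let z := -(1 / 2 : K) * (y * x' + x * y')
    let Q : Matrix (Fin 2) (Fin 2) K := !![y * y', z; z, x * x']
    let D : Matrix (Fin 2) (Fin 2) K := !![-c, a; a, b]
    ![x, y] ⬝ᵥ Q.mulVec ![x, y] = 0 ∧
    ![x', y'] ⬝ᵥ Q.mulVec ![x', y'] = 0 ∧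
    detPairing Q D = 0 := by
  intro x' y' z Q D
  have h : (1 / 2 : K) * 2 = 1 := by field_simp
  refine ⟨?_, ?_, ?_⟩
  · simp only [Q, z, Matrix.mulVec, dotProduct, Fin.sum_univ_two, Matrix.of_apply,
      Matrix.cons_val_zero, Matrix.cons_val_one]
    linear_combination (-(x * y * (y * x' + x * y'))) * h
  · simp only [Q, z, Matrix.mulVec, dotProduct, Fin.sum_univ_two, Matrix.of_apply,
      Matrix.cons_val_zero, Matrix.cons_val_one]
    linear_combination (-(x' * y' * (y * x' + x * y'))) * h
  · simp only [Q, D, z, x', y', detPairing, Matrix.of_apply,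
      Matrix.cons_val_zero, Matrix.cons_val_one]
    simp
    ring
end

section
/- Let G be a 2-dimensional subspace of the space of symmetric 2×2 matrices over K. The restriction of the determinant pairing to G is nondegenerate (i.e., the only M ∈ G with ⟨M, N⟩ = 0 for all N ∈ G is M = 0) if and only if there is no nonzero vector v ∈ K² satisfying vᵀ·M·v = 0 for every M ∈ G, i.e., if and only if the forms in G have no common nonzero isotropic vector. -/
open Matrix

theorem surj_aux {K : Type*} [Field K]
    (G : Submodule K (Matrix (Fin 2) (Fin 2) K)) (hGdim : Module.finrank K G = 2)
    (i j k l : Fin 2) (hinj : ∀ M ∈ G, M i j = 0 → M k l = 0 → M = 0) (s t : K) :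
    ∃ M ∈ G, M i j = s ∧ M k l = t := by
  let f : G →ₗ[K] (K × K) :=
    { toFun := fun M => (M.1 i j, M.1 k l)
      map_add' := by intro a b; simp
      map_smul' := by intro a b; simp }
  have hf : Function.Injective f := by
    rw [injective_iff_map_eq_zero]
    intro M hM
    have h := Prod.ext_iff.1 hM
    exact Subtype.ext (hinj M.1 M.2 h.1 h.2)
  have hs : Function.Surjective f :=
    (LinearMap.injective_iff_surjective_of_finrank_eq_finrank (by simp [hGdim])).1 hf
  obtain ⟨M, hM⟩ := hs (s, t)
  have h := Prod.ext_iff.1 hM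
  exact ⟨M.1, M.2, h.1, h.2⟩

/-- A 2-dimensional subspace `G` of the space of symmetric 2×2 matrices is
regular under the determinant pairing if and only if the forms in `G` have no
common nonzero isotropic vector. -/
theorem regular_iff_no_common_isotropic {K : Type*} [Field K] (h2 : (2 : K) ≠ 0)
    (G : Submodule K (Matrix (Fin 2) (Fin 2) K))
    (hGsymm : ∀ M ∈ G, Mᵀ = M) (hGdim : Module.finrank K G = 2) :
    (∀ M ∈ G, (∀ N ∈ G, detPairing M N = 0) → M = 0) ↔
      ¬ ∃ v : Fin 2 → K, v ≠ 0 ∧ ∀ M ∈ G, v ⬝ᵥ M.mulVec v = 0 := by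
  have hs : ∀ M ∈ G, M 1 0 = M 0 1 := fun M hM => by
    have h := congrFun (congrFun (hGsymm M hM) 0) 1
    simpa [Matrix.transpose_apply] using h
  have hq : ∀ M ∈ G, ∀ v : Fin 2 → K, v ⬝ᵥ M.mulVec v =
      v 0 ^ 2 * M 0 0 + 2 * (v 0 * v 1 * M 0 1) + v 1 ^ 2 * M 1 1 := fun M hM v => by
    simp only [dotProduct, Matrix.mulVec, Fin.sum_univ_two, hs M hM]
    ring
  have hp : ∀ M N : Matrix (Fin 2) (Fin 2) K, 2 * detPairing M N =
      M 0 0 * N 1 1 + M 1 1 * N 0 0 - 2 * (M 0 1 * N 0 1) := fun M N => by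
    unfold detPairing
    field_simp
  have hz : ∀ M ∈ G, M 0 0 = 0 → M 0 1 = 0 → M 1 1 = 0 → M = 0 := fun M hM h0 h1 h3 => by
    ext i j
    fin_cases i <;> fin_cases j <;> simp [h0, h1, h3, hs M hM]
  constructor
  · rintro hreg ⟨v, hv, hiso⟩
    have hiso' : ∀ M ∈ G,
        v 0 ^ 2 * M 0 0 + 2 * (v 0 * v 1 * M 0 1) + v 1 ^ 2 * M 1 1 = 0 :=
      fun M hM => by rw [← hq M hM v]; exact hiso M hM
    suffices h : ∃ P ∈ G, P 0 0 = v 1 ^ 2 ∧ P 0 1 = - (v 0 * v 1) ∧ P 1 1 = v 0 ^ 2 by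
      obtain ⟨P, hP, h0, h1, h3⟩ := h
      have hP0 : P = 0 := hreg P hP fun N hN => by
        have h := hp P N
        rw [h0, h1, h3] at h
        have h' : 2 * detPairing P N = 0 := by
          rw [h]; linear_combination hiso' N hN
        exact (mul_eq_zero.1 h').resolve_left h2
      rw [hP0] at h0 h3
      apply hv
      ext i
      fin_cases i
      · exact pow_eq_zero_iff (two_ne_zero) |>.1 h3.symm
      · exact pow_eq_zero_iff (two_ne_zero) |>.1 h0.symm
    by_cases hx : v 0 = 0
    · have hy : v 1 ≠ 0 := fun hy => hv (by ext i; fin_cases i <;> simp [hx, hy])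
      have h3 : ∀ M ∈ G, M 1 1 = 0 := fun M hM => by
        have h := hiso' M hM
        simpa [hx, hy] using h
      obtain ⟨P, hP, h0, h1⟩ := surj_aux G hGdim 0 0 0 1
        (fun M hM h0 h1 => hz M hM h0 h1 (h3 M hM)) (v 1 ^ 2) 0
      exact ⟨P, hP, h0, by simp [h1, hx], by simp [h3 P hP, hx]⟩
    · obtain ⟨P, hP, h1, h3⟩ := surj_aux G hGdim 0 1 1 1
        (fun M hM h1 h3 => hz M hM (by
          have h := hiso' M hM
          simpa [h1, h3, hx] using h) h1 h3) (-(v 0 * v 1)) (v 0 ^ 2)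
      refine ⟨P, hP, ?_, h1, h3⟩
      have h := hiso' P hP
      rw [h1, h3] at h
      apply mul_left_cancel₀ (pow_ne_zero 2 hx)
      linear_combination h
  · intro hno M hM hrad
    by_contra hM0
    apply hno
    have hr : ∀ N ∈ G, M 0 0 * N 1 1 + M 1 1 * N 0 0 - 2 * (M 0 1 * N 0 1) = 0 :=
      fun N hN => by rw [← hp, hrad N hN, mul_zero]
    have hd : M 0 1 ^ 2 = M 0 0 * M 1 1 := by
      apply mul_left_cancel₀ h2
      linear_combination - hr M hM
    by_cases ha : M 0 0 = 0
    · have hb : M 0 1 = 0 := by simpa [ha] using hd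
      have hc : M 1 1 ≠ 0 := fun hc => hM0 (hz M hM ha hb hc)
      refine ⟨![1, 0], fun h => by simpa using congrFun h 0, fun N hN => ?_⟩
      rw [hq N hN]
      have h := hr N hN
      simpa [ha, hb, hc] using h
    · refine ⟨![M 0 1, - M 0 0], fun h => ha (by simpa using congrFun h 1), fun N hN => ?_⟩
      rw [hq N hN]
      simp only [Matrix.cons_val_zero, Matrix.cons_val_one]
      linear_combination M 0 0 * hr N hN + N 0 0 * hd
end

section
/- Let E be a 2-dimensional K-vector space, L an algebraic closure of K, and W a 2-dimensional subspace of the space of symmetric bilinear forms on E. Then the following are equivalent: (1) there is no nonzero vector v ∈ E with q(v, v) = 0 for all q ∈ W; (2) there exist R, S ∈ W such that no nonzero vector v in the base change L ⊗_K E satisfies both (baseChange of R to L)(v, v) = 0 and (baseChange of S to L)(v, v) = 0; that is, the pencil contains two quadrics whose intersection points with the line, taken over an algebraic closure of K, are disjoint. -/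
open TensorProduct


theorem aux_resultant {L : Type*} [Field L] (a b c a' b' c' x y : L)
    (h1 : a * x ^ 2 + b * (x * y) + c * y ^ 2 = 0)
    (h2 : a' * x ^ 2 + b' * (x * y) + c' * y ^ 2 = 0) (hxy : x ≠ 0 ∨ y ≠ 0) :
    (c * a' - a * c') ^ 2 = (b * c' - c * b') * (a * b' - b * a') := by
  have e1 : x * (x * (c * a' - a * c')) = x * (y * (b * c' - c * b')) := by
    linear_combination c * h2 - c' * h1
  have e2 : y * (x * (a * b' - b * a')) = y * (y * (c * a' - a * c')) := by
    linear_combination a' * h1 * (-1) + a * h2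
  have e3 : x ^ 2 * (a * b' - b * a') = y ^ 2 * (b * c' - c * b') := by
    linear_combination b' * h1 - b * h2
  rcases hxy with h | h
  · have f1 := mul_left_cancel₀ h e1
    have h' : x ^ 2 ≠ 0 := pow_ne_zero 2 h
    apply mul_left_cancel₀ h'
    linear_combination (x * (c * a' - a * c') + y * (b * c' - c * b')) * f1
      - (b * c' - c * b') * e3
  · have f1 := mul_left_cancel₀ h e2
    have h' : y ^ 2 ≠ 0 := pow_ne_zero 2 h
    apply mul_left_cancel₀ h'
    linear_combination -(x * (a * b' - b * a') + y * (c * a' - a * c')) * f1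
      + (a * b' - b * a') * e3

/-- A pencil of quadrics on a 2-dimensional space `E` has no common isotropic
point on the line if and only if it contains two quadrics whose intersection
points with the line, taken over an algebraic closure `L` of `K`, are
disjoint. -/
theorem no_common_isotropic_iff_two_disjoint_over_closure
    {K : Type*} [Field K] (h2 : (2 : K) ≠ 0)
    (L : Type*) [Field L] [Algebra K L] [IsAlgClosure K L]
    {E : Type*} [AddCommGroup E] [Module K E] (hE : Module.finrank K E = 2)
    (W : Submodule K (E →ₗ[K] E →ₗ[K] K))
    (hWsymm : ∀ q ∈ W, ∀ x y : E, q x y = q y x)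
    (hWdim : Module.finrank K W = 2) :
    (¬ ∃ v : E, v ≠ 0 ∧ ∀ q ∈ W, q v v = 0) ↔
      (∃ R ∈ W, ∃ S ∈ W,
        ¬ ∃ v : L ⊗[K] E, v ≠ 0 ∧
          LinearMap.BilinForm.baseChange L R v v = 0 ∧
          LinearMap.BilinForm.baseChange L S v v = 0) := by
  constructor
  · intro h
    have : Module.Finite K E := Module.finite_of_finrank_pos (by omega)
    have : Module.Free K W := by
      letI : AddCommGroup W := Module.addCommMonoidToAddCommGroup K
      exact Module.Free.of_divisionRing K W
    have : Module.Finite K W := Module.finite_of_finrank_pos (by omega)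
    let e := Module.finBasisOfFinrankEq K E hE
    let f := Module.finBasisOfFinrankEq K W hWdim
    have key : ∀ (q : E →ₗ[K] E →ₗ[K] K), q ∈ W → ∀ x y : K,
        q (x • e 0 + y • e 1) (x • e 0 + y • e 1) =
        q (e 0) (e 0) * x ^ 2 + (2 * q (e 0) (e 1)) * (x * y) + q (e 1) (e 1) * y ^ 2 := by
      intro q hq x y
      simp only [map_add, map_smul, LinearMap.add_apply, LinearMap.smul_apply, smul_eq_mul,
        hWsymm q hq (e 1) (e 0)]
      ring
    have keyL : ∀ (q : E →ₗ[K] E →ₗ[K] K), q ∈ W → ∀ x y : L,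
        LinearMap.BilinForm.baseChange L q (x • ((1 : L) ⊗ₜ[K] e 0) + y • ((1 : L) ⊗ₜ[K] e 1))
          (x • ((1 : L) ⊗ₜ[K] e 0) + y • ((1 : L) ⊗ₜ[K] e 1)) =
        algebraMap K L (q (e 0) (e 0)) * x ^ 2
          + algebraMap K L (2 * q (e 0) (e 1)) * (x * y)
          + algebraMap K L (q (e 1) (e 1)) * y ^ 2 := by
      intro q hq x y
      simp only [map_add, map_smul, LinearMap.add_apply, LinearMap.smul_apply, smul_eq_mul,
        LinearMap.BilinForm.baseChange_tmul, hWsymm q hq (e 1) (e 0), Algebra.smul_def, map_mul,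
        map_ofNat]
      ring
    have hR : ((f 0 : W) : E →ₗ[K] E →ₗ[K] K) ∈ W := (f 0).2
    have hS : ((f 1 : W) : E →ₗ[K] E →ₗ[K] K) ∈ W := (f 1).2
    have hspan : ∀ q ∈ W, ∃ s t : K, q = s • (f 0 : E →ₗ[K] E →ₗ[K] K) + t • (f 1 : E →ₗ[K] E →ₗ[K] K) := by
      intro q hq
      refine ⟨f.repr ⟨q, hq⟩ 0, f.repr ⟨q, hq⟩ 1, ?_⟩
      have := congrArg Subtype.val (f.sum_repr ⟨q, hq⟩)
      rw [Fin.sum_univ_two] at this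
      exact this.symm
    have hind : ∀ s t : K, s • (f 0 : E →ₗ[K] E →ₗ[K] K) + t • (f 1 : E →ₗ[K] E →ₗ[K] K) = 0 →
        s = 0 ∧ t = 0 := by
      intro s t hst
      have h3 : s • f 0 + t • f 1 = 0 := Subtype.ext hst
      have h4 := congrArg f.repr h3
      simp only [map_add, map_smul, Module.Basis.repr_self, map_zero] at h4
      have h5 := DFunLike.congr_fun h4 0
      have h6 := DFunLike.congr_fun h4 1
      simp at h5 h6
      exact ⟨h5, h6⟩
    refine ⟨f 0, hR, f 1, hS, ?_⟩
    generalize (f 0 : E →ₗ[K] E →ₗ[K] K) = R at *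
    generalize (f 1 : E →ₗ[K] E →ₗ[K] K) = S at *
    rintro ⟨v, hv, hv1, hv2⟩
    let eL := e.baseChange L
    have hvxy : v = eL.repr v 0 • ((1 : L) ⊗ₜ[K] e 0) + eL.repr v 1 • ((1 : L) ⊗ₜ[K] e 1) := by
      have := eL.sum_repr v
      rw [Fin.sum_univ_two] at this
      simpa [eL] using this.symm
    generalize eL.repr v 0 = x at *
    generalize eL.repr v 1 = y at *
    have hxy : x ≠ 0 ∨ y ≠ 0 := by
      by_contra! hh
      apply hv
      rw [hvxy, hh.1, hh.2]
      simp
    rw [hvxy, keyL R hR] at hv1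
    rw [hvxy, keyL S hS] at hv2
    have res := aux_resultant _ _ _ _ _ _ x y hv1 hv2 hxy
    simp only [← map_mul, ← map_sub, ← map_pow] at res
    have res' := (algebraMap K L).injective res
    have kR := key R hR
    have kS := key S hS
    have ext0 : ∀ q ∈ W, q (e 0) (e 0) = 0 → 2 * q (e 0) (e 1) = 0 → q (e 1) (e 1) = 0 →
        q = 0 := by
      intro q hq h00 h01 h11
      have h01' : q (e 0) (e 1) = 0 := (mul_eq_zero.mp h01).resolve_left h2
      refine e.ext fun i => e.ext fun j => ?_
      fin_cases i <;> fin_cases j <;> simp [h00, h01', h11, hWsymm q hq (e 1) (e 0)]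
    have hmem : ∀ s t : K, s • R + t • S ∈ W := fun s t =>
      W.add_mem (W.smul_mem s hR) (W.smul_mem t hS)
    have dep : ∀ s t : K, s * R (e 0) (e 0) + t * S (e 0) (e 0) = 0 →
        s * (2 * R (e 0) (e 1)) + t * (2 * S (e 0) (e 1)) = 0 →
        s * R (e 1) (e 1) + t * S (e 1) (e 1) = 0 → s = 0 ∧ t = 0 := by
      intro s t g1 g2 g3
      apply hind
      apply ext0 _ (hmem s t)
      · simpa using g1
      · simp only [LinearMap.add_apply, LinearMap.smul_apply, smul_eq_mul]
        linear_combination g2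
      · simpa using g3
    generalize R (e 0) (e 0) = a at *
    generalize 2 * R (e 0) (e 1) = b at *
    generalize R (e 1) (e 1) = c at *
    generalize S (e 0) (e 0) = a' at *
    generalize 2 * S (e 0) (e 1) = b' at *
    generalize S (e 1) (e 1) = c' at *
    have fin : ∀ X Y : K, (X ≠ 0 ∨ Y ≠ 0) → a * X ^ 2 + b * (X * Y) + c * Y ^ 2 = 0 →
        a' * X ^ 2 + b' * (X * Y) + c' * Y ^ 2 = 0 → False := by
      intro X Y hXY g1 g2
      refine h ⟨X • e 0 + Y • e 1, ?_, ?_⟩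
      · intro h0
        have := e.linearIndependent
        rw [Fintype.linearIndependent_iff] at this
        have h3 := this ![X, Y] (by
          rw [Fin.sum_univ_two]
          exact h0)
        have hX : X = 0 := h3 0
        have hY : Y = 0 := h3 1
        tauto
      · intro q hq
        obtain ⟨s, t, rfl⟩ := hspan q hq
        rw [LinearMap.add_apply, LinearMap.add_apply, LinearMap.smul_apply, LinearMap.smul_apply,
          LinearMap.smul_apply, LinearMap.smul_apply, kR, kS, g1, g2]
        simp
    by_cases hAB : b * c' - c * b' = 0 ∧ c * a' - a * c' = 0
    · by_cases hC : a * b' - b * a' = 0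
      · obtain ⟨hA, hB⟩ := hAB
        have d1 := dep (-a') a (by ring) (by linear_combination hC) (by linear_combination -hB)
        have d2 := dep (-b') b (by linear_combination -hC) (by ring) (by linear_combination hA)
        have d3 := dep (-c') c (by linear_combination hB) (by linear_combination -hA) (by ring)
        have d4 := dep 1 0 (by simp [d1.2]) (by simp [d2.2]) (by simp [d3.2])
        exact one_ne_zero d4.1
      · refine fin (c * a' - a * c') (a * b' - b * a') (Or.inr hC) ?_ ?_
        · linear_combination a * res'
        · linear_combination a' * res'
    · refine fin (b * c' - c * b') (c * a' - a * c') (by tauto) ?_ ?_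
      · linear_combination c * res'
      · linear_combination c' * res'
  · rintro ⟨R, hR, S, hS, h⟩ ⟨v, hv, hq⟩
    apply h
    refine ⟨(1 : L) ⊗ₜ[K] v, ?_, ?_, ?_⟩
    · intro h0
      apply hv
      exact Module.FaithfullyFlat.tensorProduct_mk_injective (A := K) (B := L) E (by simpa using h0)
    · simp [LinearMap.BilinForm.baseChange_tmul, hq R hR]
    · simp [LinearMap.BilinForm.baseChange_tmul, hq S hS]
end

section
/- Let E be a 2-dimensional K-vector space and σ a linear automorphism of E with σ ∘ σ = c·id for some nonzero c ∈ K and σ not a scalar multiple of the identity. Suppose m, n ∈ E are linearly independent with σ(m) ∈ span{m} and σ(n) ∈ span{n} (so the lines spanned by m and n are the fixed points of the induced involution). Then for nonzero vectors s = α·m + β·n and t = λ·m + μ·n, one has σ(s) ∈ span{t} if and only if α·μ + β·λ = 0. That is, two points are conjugate under the unique involution with fixed points spanned by m and n exactly when their cross ratio with those fixed points is −1. -/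
/-- For the involution of the projective line with fixed points spanned by `m`
and `n`, the points spanned by `s = α·m + β·n` and `t = λ·m + μ·n` are conjugate
if and only if `α·μ + β·λ = 0`, i.e. exactly when their cross ratio with the
fixed points is `−1`. -/
theorem conjugate_iff_harmonic {K E : Type*} [Field K] (h2 : (2 : K) ≠ 0)
    [AddCommGroup E] [Module K E] (hE : Module.finrank K E = 2)
    (σ : E ≃ₗ[K] E) (c : K) (hc : c ≠ 0)
    (hinv : ∀ v : E, σ (σ v) = c • v)
    (hns : ¬ ∃ k : K, ∀ v : E, σ v = k • v)
    (m n : E) (hmn : LinearIndependent K ![m, n])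
    (hm : σ m ∈ Submodule.span K {m}) (hn : σ n ∈ Submodule.span K {n})
    (α β lam μ : K) (s t : E)
    (hsdef : s = α • m + β • n) (htdef : t = lam • m + μ • n)
    (hs : s ≠ 0) (ht : t ≠ 0) :
    σ s ∈ Submodule.span K {t} ↔ α * μ + β * lam = 0 := by
  have hspan : ∀ v : E, ∃ x y : K, x • m + y • n = v := by
    intro v
    haveI : FiniteDimensional K E := Module.finite_of_finrank_pos (by omega)
    have h := hmn.span_eq_top_of_card_eq_finrank' (by simp [hE])
    have hv : v ∈ Submodule.span K (Set.range ![m, n]) := by rw [h]; trivial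
    rw [Matrix.range_cons, Matrix.range_cons, Matrix.range_empty, Set.union_empty,
      Set.singleton_union] at hv
    exact Submodule.mem_span_pair.1 hv
  rw [LinearIndependent.pair_iff] at hmn
  obtain ⟨a, ha⟩ := Submodule.mem_span_singleton.1 hm
  obtain ⟨b, hb⟩ := Submodule.mem_span_singleton.1 hn
  have haa : a * a = c := by
    have h := hinv m
    rw [← ha, map_smul, ← ha, smul_smul] at h
    have := (hmn (a * a - c) 0 (by rw [sub_smul, h]; simp)).1
    exact sub_eq_zero.1 this
  have hbb : b * b = c := by
    have h := hinv n
    rw [← hb, map_smul, ← hb, smul_smul] at h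
    have := (hmn 0 (b * b - c) (by rw [sub_smul, h]; simp)).2
    exact sub_eq_zero.1 this
  have ha0 : a ≠ 0 := by
    rintro rfl
    exact hc (by rw [← haa]; simp)
  have hab : b = -a := by
    rcases mul_self_eq_mul_self_iff.1 (hbb.trans haa.symm) with h | h
    · exfalso
      refine hns ⟨a, fun v => ?_⟩
      obtain ⟨x, y, rfl⟩ := hspan v
      rw [map_add, map_smul, map_smul, ← ha, ← hb, h]
      module
    · exact h
  have hσs : σ s = (α * a) • m + (-(β * a)) • n := by
    rw [hsdef, map_add, map_smul, map_smul, ← ha, ← hb, hab]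
    module
  rw [Submodule.mem_span_singleton, hσs, htdef]
  constructor
  · rintro ⟨k, hk⟩
    obtain ⟨h1, h3⟩ := hmn (k * lam - α * a) (k * μ + β * a) (by
      rw [← sub_eq_zero] at hk
      rw [← hk]
      module)
    have : a * (α * μ + β * lam) = 0 := by linear_combination lam * h3 - μ * h1
    exact (mul_eq_zero.1 this).resolve_left ha0
  · intro h
    suffices hk : ∃ k : K, k * lam = α * a ∧ k * μ = -(β * a) by
      obtain ⟨k, h1, h3⟩ := hk
      exact ⟨k, by rw [← h1, ← h3]; module⟩
    by_cases hl : lam = 0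
    · have hμ : μ ≠ 0 := by
        rintro rfl
        exact ht (by rw [htdef, hl]; simp)
      have hα : α = 0 := by
        rw [hl, mul_zero, add_zero] at h
        exact (mul_eq_zero.1 h).resolve_right hμ
      exact ⟨-(β * a) / μ, by rw [hl, hα]; simp, div_mul_cancel₀ _ hμ⟩
    · refine ⟨α * a / lam, div_mul_cancel₀ _ hl, ?_⟩
      rw [div_mul_eq_mul_div, div_eq_iff hl]
      linear_combination a * h
end

section
/- Let a, b, c ∈ K with a² + b·c ≠ 0, let T = [[a, b], [c, −a]], and let D = [[−c, a], [a, b]] be its Desargues form. For each (x, y) ≠ (0, 0) in K², let Q_{(x,y)} denote the symmetric matrix [[y·y', z], [z, x·x']] where x' = a·x + b·y, y' = c·x − a·y and z = −(1/2)·(y·x' + x·y') (the form whose isotropic vectors are the conjugate pair (x, y), (x', y') of the involution induced by T). Then a symmetric 2×2 matrix S satisfies ⟨S, Q_{(x,y)}⟩ = 0 for every nonzero (x, y) ∈ K² if and only if S is a scalar multiple of D. In other words, the forms associated with the conjugate pairs of the involution span a 2-dimensional space whose orthogonal complement under the determinant pairing is exactly the line spanned by the Desargues form. -/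
open Matrix

/-- The symmetric form whose isotropic vectors are the conjugate pair
`(x, y)`, `(x', y') = (a·x + b·y, c·x − a·y)` of the involution induced by the
traceless matrix `T = [[a, b], [c, −a]]`. -/
def conjPairForm {K : Type*} [Field K] (a b c x y : K) : Matrix (Fin 2) (Fin 2) K :=
  let x' := a * x + b * y
  let y' := c * x - a * y
  let z := -(1 / 2 : K) * (y * x' + x * y')
  !![y * y', z; z, x * x']

/-- A symmetric 2×2 matrix is orthogonal, under the determinant pairing, to all
the forms associated with the conjugate pairs of the involution induced by the
invertible traceless matrix `T = [[a, b], [c, −a]]` if and only if it is a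
scalar multiple of the Desargues form `D = [[−c, a], [a, b]]`: the forms of
the conjugate pairs span a plane whose orthogonal complement is the line
spanned by the Desargues form. -/
theorem orthogonal_to_conjugate_pairs_iff_desargues {K : Type*} [Field K]
    (h2 : (2 : K) ≠ 0) (a b c : K) (hT : a ^ 2 + b * c ≠ 0)
    (S : Matrix (Fin 2) (Fin 2) K) (hS : Sᵀ = S) :
    (∀ x y : K, (x, y) ≠ (0, 0) → detPairing S (conjPairForm a b c x y) = 0) ↔
      ∃ k : K, S = k • (!![-c, a; a, b] : Matrix (Fin 2) (Fin 2) K) := by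
  have hs : S 1 0 = S 0 1 := congrFun (congrFun hS 0) 1
  have key : ∀ x y : K, 2 * detPairing S (conjPairForm a b c x y) =
      x ^ 2 * (S 0 0 * a + S 0 1 * c) + x * y * (S 0 0 * b + S 1 1 * c)
        + y ^ 2 * (S 0 1 * b - S 1 1 * a) := by
    intro x y
    simp [detPairing, conjPairForm]
    field_simp
    ring
  constructor
  · intro h
    have e1 := key 1 0
    have e2 := key 0 1
    have e3 := key 1 1
    rw [h _ _ (by simp)] at e1 e2 e3
    have f1 : S 0 0 * a + S 0 1 * c = 0 := by linear_combination -e1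
    have f2 : S 0 1 * b - S 1 1 * a = 0 := by linear_combination -e2
    have f3 : S 0 0 * b + S 1 1 * c = 0 := by linear_combination -e3 + e1 + e2
    refine ⟨(a * S 0 1 - b * S 0 0) / (a ^ 2 + b * c), ?_⟩
    ext i j
    fin_cases i <;> fin_cases j <;> simp [hs] <;> rw [eq_comm, ← sub_eq_zero]
    · field_simp
      linear_combination -a * f1
    · field_simp
      linear_combination -b * f1
    · field_simp
      linear_combination -b * f1
    · field_simp
      linear_combination a * f2 - b * f3
  · rintro ⟨k, rfl⟩ x y -
    have := key x y
    simp at this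
    refine (mul_eq_zero.1 ((key x y).trans ?_)).resolve_left h2
    simp
    ring
end
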